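/- arXiv:1907.02623 — 2 statements merged into one kernel-verified Lean document; each statement's English description precedes it below -/
import Mathlib

section
/- Let q ≡ 3 (mod 4) be a prime power, let F be a finite field with q² elements with primitive element ω, and let e be the exact power of 2 dividing q + 1 (i.e., e = 2^v where 2^v divides q+1 but 2^{v+1} does not). Let α < e be an odd positive integer and set β = (qe − α(q+1))/(2e). Let A ⊆ {0,1,…,2e−1} with |A| = α and let B₀,…,B_{e−1} ⊆ {0,1,…,q} with |B₀| = ⋯ = |B_{e−1}| = β, such that b ≢ a (mod e) for all a ∈ A and all b ∈ B₀ ∪ ⋯ ∪ B_{e−1}. Set H = ⋃_{i∈A} Cᵢ⁽²ᵉ⁾, Mᵣ = ⋃_{j∈Bᵣ} Cⱼ⁽q⁺¹⁾ for r = 0,…,e−1, and Dᵣ = ω^r·(H ∪ Mᵣ). Then |Dᵣ| = q(q−1)/2 for each r, and for every nonzero x ∈ F, Σᵣ₌₀^{e−1} N(Dᵣ,Dᵣ;x) = eq(q−2)/4; i.e., {Dᵣ : r = 0,…,e−1} is a difference family in (F,+) with λ = eq(q−2)/4. -/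
/-- The number of pairs `(u, v) ∈ A × B` with `u - v = g`. -/
noncomputable def diffCount {G : Type*} [AddGroup G] (A B : Set G) (g : G) : ℕ :=
  Set.ncard {p : G × G | p.1 ∈ A ∧ p.2 ∈ B ∧ p.1 - p.2 = g}

/-- The `N`-th cyclotomic class `C_i^{(N)} = {ω^(i+Nk) : k ∈ ℤ}`. -/
def cyc {F : Type*} [Field F] (ω : F) (N : ℕ) (i : ℤ) : Set F :=
  {x : F | ∃ k : ℤ, x = ω ^ (i + (N : ℤ) * k)}

/-- The autocorrelation-type sum `∑ v, f (v + x) * g v`. -/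
def correlation {F : Type*} [Field F] [Fintype F] (f g : F → ℤ) (x : F) : ℤ :=
  ∑ v, f (v + x) * g v

section Lines

variable {F : Type*} [Field F] {K : Subfield F} [Fintype K]

theorem sum_smul_of_invariant {f : F → ℤ} (hf0 : f 0 = 0)
    (hf : ∀ c : K, c ≠ 0 → ∀ x, f (c * x) = f x) (x : F) :
    ∑ l : K, f (l * x) = (Fintype.card K - 1) * f x := by
  classical
  rw [← Finset.add_sum_erase _ _ (Finset.mem_univ (0 : K)),
    Finset.sum_congr rfl (fun l hl => hf l (Finset.ne_of_mem_erase hl) x)]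
  simp [hf0, Finset.card_erase_of_mem, Nat.cast_sub Fintype.card_pos]

/-- A line `v + K x` missing the origin meets every one-dimensional subspace other than `K x`
exactly once. -/
theorem sum_affine_line_of_notMem [Fintype F]
    (hcard : Fintype.card F = Fintype.card K ^ 2) {f : F → ℤ}
    (hf0 : f 0 = 0) (hf : ∀ c : K, c ≠ 0 → ∀ x, f (c * x) = f x) {x v : F} (hx : x ≠ 0)
    (hv : ∀ c : K, v ≠ c * x) :
    (Fintype.card K - 1) * ∑ l : K, f (v + l * x) =
      ∑ w, f w - (Fintype.card K - 1) * f x := by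
  classical
  have hinj : Function.Injective (fun p : K × K => (p.1 : F) * v + p.2 * x) := by
    rintro ⟨a, b⟩ ⟨c, d⟩ h
    simp only at h
    have hac : a = c := by
      by_contra hne
      have hne' : (a : F) - c ≠ 0 := sub_ne_zero.2 fun h => hne (Subtype.ext h)
      apply hv ((d - b) / (a - c))
      push_cast
      field_simp
      linear_combination h
    subst hac
    have : (b : F) = d := mul_right_cancel₀ hx (by linear_combination h)
    simpa using Subtype.ext this
  have hbij : Function.Bijective (fun p : K × K => (p.1 : F) * v + p.2 * x) :=
    (Fintype.bijective_iff_injective_and_card _).2 ⟨hinj, by simp [hcard, sq]⟩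
  have hsum : ∑ w, f w = ∑ m : K, ∑ l : K, f (m * v + l * x) := by
    rw [← Fintype.sum_prod_type' (f := fun m l : K => f (m * v + l * x))]
    exact (hbij.sum_comp f).symm
  have hinner (m : K) (hm : m ≠ 0) : ∑ l : K, f (m * v + l * x) = ∑ l : K, f (v + l * x) := by
    rw [← (mulLeft_bijective₀ m hm).sum_comp]
    refine Finset.sum_congr rfl fun l _ => ?_
    rw [← hf m hm (v + l * x)]
    congr 1
    push_cast
    ring
  rw [hsum, ← Finset.add_sum_erase _ (fun m : K => ∑ l : K, f (m * v + l * x))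
      (Finset.mem_univ (0 : K)),
    Finset.sum_congr rfl (fun m hm => hinner m (Finset.ne_of_mem_erase hm))]
  have := sum_smul_of_invariant hf0 hf x
  simp [Finset.card_erase_of_mem, Nat.cast_sub Fintype.card_pos, this]

theorem correlation_of_invariant [Fintype F]
    (hcard : Fintype.card F = Fintype.card K ^ 2) {f g : F → ℤ}
    (hf0 : f 0 = 0) (hf : ∀ c : K, c ≠ 0 → ∀ x, f (c * x) = f x)
    (hg0 : g 0 = 0) (hg : ∀ c : K, c ≠ 0 → ∀ x, g (c * x) = g x) {x : F} (hx : x ≠ 0) :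
    ((Fintype.card K : ℤ) - 1) ^ 2 * correlation f g x =
      (∑ w, f w) * ∑ w, g w - (Fintype.card K - 1) * f x * ∑ w, g w
        - (Fintype.card K - 1) * g x * ∑ w, f w
        + (Fintype.card K - 1) ^ 2 * Fintype.card K * (f x * g x)
        - (Fintype.card K - 1) * ∑ w, f w * g w := by
  classical
  set n : ℤ := (Fintype.card K : ℤ) with hn
  have hscale (l : K) (hl : l ≠ 0) : ∑ v, f (v + l * x) * g v = correlation f g x := by
    have hl' : (l : F) ≠ 0 := fun h => hl (Subtype.ext h)
    rw [correlation, ← (mulLeft_bijective₀ (l : F) hl').sum_comp]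
    refine Finset.sum_congr rfl fun v _ => ?_
    rw [hg l hl, ← mul_add, hf l hl]
  have h1 : (n - 1) * correlation f g x =
      ∑ v, g v * ∑ l : K, f (v + l * x) - ∑ v, f v * g v := by
    have : ∑ v, g v * ∑ l : K, f (v + l * x) = ∑ l : K, ∑ v, f (v + l * x) * g v := by
      rw [Finset.sum_comm]
      exact Finset.sum_congr rfl fun v _ => by rw [Finset.mul_sum]; simp only [mul_comm]
    rw [this, ← Finset.add_sum_erase _ _ (Finset.mem_univ (0 : K)),
      Finset.sum_congr rfl (fun l hl => hscale l (Finset.ne_of_mem_erase hl))]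
    simp [Finset.card_erase_of_mem, Nat.cast_sub Fintype.card_pos, hn]
  have hline (v : F) : (n - 1) * ∑ l : K, f (v + l * x) = (∑ w, f w - (n - 1) * f x)
      + if ∃ c : K, v = c * x then (n - 1) * n * f x - ∑ w, f w else 0 := by
    split_ifs with h
    · obtain ⟨c, rfl⟩ := h
      have : ∑ l : K, f (c * x + l * x) = (n - 1) * f x := by
        rw [← sum_smul_of_invariant hf0 hf,
          ← Equiv.sum_comp (Equiv.addLeft c) (fun l : K => f (l * x))]
        refine Finset.sum_congr rfl fun l _ => ?_
        simp [add_mul]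
      rw [this]
      ring
    · push Not at h
      rw [sum_affine_line_of_notMem hcard hf0 hf hx h, add_zero]
  have hg' : ∑ v, (if ∃ c : K, v = c * x then g v else 0) = (n - 1) * g x := by
    rw [← sum_smul_of_invariant hg0 hg, ← Finset.sum_filter]
    symm
    refine Finset.sum_bij (fun (l : K) _ => (l : F) * x)
      (fun l _ => Finset.mem_filter.2 ⟨Finset.mem_univ _, l, rfl⟩) ?_ ?_ (fun _ _ => rfl)
    · intro a _ b _ h
      exact Subtype.ext (mul_right_cancel₀ hx h)
    · intro b hb
      obtain ⟨c, hc⟩ := (Finset.mem_filter.1 hb).2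
      exact ⟨c, Finset.mem_univ _, hc.symm⟩
  have h2 : (n - 1) * ∑ v, g v * ∑ l : K, f (v + l * x) =
      (∑ w, f w - (n - 1) * f x) * ∑ v, g v +
        ((n - 1) * n * f x - ∑ w, f w) * ((n - 1) * g x) := by
    rw [← hg', Finset.mul_sum, Finset.mul_sum, Finset.mul_sum, ← Finset.sum_add_distrib]
    refine Finset.sum_congr rfl fun v _ => ?_
    rw [mul_left_comm, hline]
    split_ifs <;> ring
  linear_combination (n - 1) * h1 + h2

end Lines

section Orbits

variable {F : Type*} [Field F]

theorem apply_pow_mul_of_invariant {Y : Type*} {f : F → Y} {w : F} (h : ∀ x, f (w * x) = f x)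
    (k : ℕ) (x : F) : f (w ^ k * x) = f x := by
  induction k with
  | zero => simp
  | succ k ih => rw [pow_succ', mul_assoc, h, ih]

theorem card_mul_sum_range_of_invariant [Fintype F] {w : F} (hw0 : w ≠ 0)
    (hw : ∀ x : F, x ≠ 0 → ∃ k : ℕ, x = w ^ k) {N : ℕ} {f : F → ℤ}
    (hf : ∀ x, f (w ^ N * x) = f x) {x : F} (hx : x ≠ 0) :
    ((Fintype.card F : ℤ) - 1) * ∑ r ∈ Finset.range N, f (w ^ r * x) =
      N * (∑ y, f y - f 0) := by
  classical
  set T : F → ℤ := fun x => ∑ r ∈ Finset.range N, f (w ^ r * x) with hT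
  have hstep (x : F) : T (w * x) = T x := by
    have h1 := Finset.sum_range_succ (fun r => f (w ^ r * x)) N
    have h2 := Finset.sum_range_succ' (fun r => f (w ^ r * x)) N
    simp only [hf, pow_zero, one_mul] at h1 h2
    simp only [hT, ← mul_assoc, ← pow_succ]
    linarith
  have hconst (y : F) (hy : y ≠ 0) : T y = T x := by
    obtain ⟨k, hk⟩ := hw (y / x) (div_ne_zero hy hx)
    rw [(div_eq_iff hx).1 hk, apply_pow_mul_of_invariant hstep]
  have hsum : ∑ y, T y = N * ∑ y, f y := by
    rw [hT, Finset.sum_comm,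
      Finset.sum_congr rfl (fun r _ => (mulLeft_bijective₀ (w ^ r) (pow_ne_zero r hw0)).sum_comp f)]
    simp
  rw [← Finset.add_sum_erase _ _ (Finset.mem_univ (0 : F)),
    Finset.sum_congr rfl (fun y hy => hconst y (Finset.ne_of_mem_erase hy))] at hsum
  have h0 : T 0 = N * f 0 := by simp [hT]
  rw [h0] at hsum
  simp only [Finset.sum_const, Finset.card_erase_of_mem (Finset.mem_univ (0 : F)),
    Finset.card_univ, nsmul_eq_mul, Nat.cast_sub (Fintype.card_pos (α := F)), Nat.cast_one] at hsum
  change _ * T x = _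
  linarith

end Orbits

section Cyclotomic

variable {F : Type*} [Field F] {ω : F}

theorem orderOf_primitive [Fintype F] (hω : ∀ x : F, x ≠ 0 → ∃ k : ℕ, x = ω ^ k) (hω0 : ω ≠ 0) :
    orderOf ω = Fintype.card F - 1 := by
  classical
  have h : ∀ x : Fˣ, x ∈ Subgroup.zpowers (Units.mk0 ω hω0) := fun x => by
    obtain ⟨k, hk⟩ := hω x x.ne_zero
    exact ⟨k, Units.ext (by simp [hk])⟩
  rw [← Fintype.card_units, ← Nat.card_eq_fintype_card, ← orderOf_eq_card_of_forall_mem_zpowers h,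
    ← orderOf_units, Units.val_mk0]

theorem zero_notMem_cyc (hω0 : ω ≠ 0) (N : ℕ) (i : ℤ) : (0 : F) ∉ cyc ω N i :=
  fun ⟨_, hk⟩ => zpow_ne_zero _ hω0 hk.symm

theorem mul_mem_cyc_iff (hω0 : ω ≠ 0) (N : ℕ) (i : ℤ) (x : F) :
    ω ^ N * x ∈ cyc ω N i ↔ x ∈ cyc ω N i := by
  constructor
  · rintro ⟨k, hk⟩
    refine ⟨k - 1, mul_left_cancel₀ (pow_ne_zero N hω0) ?_⟩
    rw [hk, ← zpow_natCast ω N, ← zpow_add₀ hω0]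
    ring_nf
  · rintro ⟨k, rfl⟩
    refine ⟨k + 1, ?_⟩
    rw [← zpow_natCast ω N, ← zpow_add₀ hω0]
    ring_nf

theorem dvd_sub_of_zpow_eq (hω0 : ω ≠ 0) {a b : ℤ} (h : ω ^ a = ω ^ b) :
    (orderOf ω : ℤ) ∣ a - b := by
  rw [← Units.val_mk0 hω0, orderOf_units, orderOf_dvd_iff_zpow_eq_one]
  ext
  simp [zpow_sub₀ hω0, h, zpow_ne_zero _ hω0]

theorem pow_mem_cyc_iff (hω0 : ω ≠ 0) {N : ℕ} (hN : N ∣ orderOf ω) {r i : ℕ}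
    (hr : r < N) (hi : i < N) : ω ^ r ∈ cyc ω N i ↔ r = i := by
  constructor
  · rintro ⟨k, hk⟩
    rw [← zpow_natCast] at hk
    have h := (Int.natCast_dvd_natCast.2 hN).trans (dvd_sub_of_zpow_eq hω0 hk)
    have h' : (N : ℤ) ∣ (r : ℤ) - i := by
      have := h.add (dvd_mul_right (N : ℤ) k)
      ring_nf at this ⊢
      exact this
    have := Int.eq_zero_of_abs_lt_dvd h' (by rw [abs_lt]; omega)
    omega
  · rintro rfl
    exact ⟨0, by simp⟩

open Classical in
/-- The number of elements in a union of cyclotomic classes. -/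
theorem sum_indicator_cyc [Fintype F] (hω : ∀ x : F, x ≠ 0 → ∃ k : ℕ, x = ω ^ k) (hω0 : ω ≠ 0)
    {N : ℕ} (hN : N ∣ Fintype.card F - 1) {S : Finset ℕ} (hS : S ⊆ Finset.range N) :
    (N : ℤ) * ∑ y : F, (if y ∈ ⋃ i ∈ S, cyc ω N (i : ℤ) then 1 else 0) =
      (Fintype.card F - 1) * S.card := by
  have hf : ∀ x : F, (if ω ^ N * x ∈ ⋃ i ∈ S, cyc ω N (i : ℤ) then (1 : ℤ) else 0) =
      if x ∈ ⋃ i ∈ S, cyc ω N (i : ℤ) then 1 else 0 := fun x => by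
    simp only [Set.mem_iUnion, mul_mem_cyc_iff hω0]
  have h := card_mul_sum_range_of_invariant
    (f := fun x => if x ∈ ⋃ i ∈ S, cyc ω N (i : ℤ) then 1 else 0) hω0 hω hf one_ne_zero
  have h0 : (0 : F) ∉ ⋃ i ∈ S, cyc ω N (i : ℤ) := by simp [zero_notMem_cyc hω0]
  rw [if_neg h0, sub_zero] at h
  rw [← h]
  congr 1
  rw [Finset.sum_congr rfl (g := fun r => if r ∈ S then (1 : ℤ) else 0)]
  · rw [Finset.sum_ite_mem, Finset.inter_eq_right.2 hS]
    simp
  · intro r hr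
    have : ω ^ r * 1 ∈ ⋃ i ∈ S, cyc ω N (i : ℤ) ↔ r ∈ S := by
      simp only [mul_one, Set.mem_iUnion, exists_prop]
      constructor
      · rintro ⟨i, hi, h⟩
        rw [orderOf_primitive hω hω0 |>.symm] at hN
        rwa [(pow_mem_cyc_iff hω0 hN (Finset.mem_range.1 hr) (Finset.mem_range.1 (hS hi))).1 h]
      · exact fun h => ⟨r, h, 0, by simp⟩
    simp only [this]

end Cyclotomic

/-- The subfield of order `q` and the description of its nonzero elements. -/
theorem exists_subfield_card {F : Type*} [Field F] [Fintype F] {q : ℕ} (hq : IsPrimePow q)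
    (hF : Fintype.card F = q ^ 2) {ω : F} (hω : ∀ x : F, x ≠ 0 → ∃ k : ℕ, x = ω ^ k)
    (hω0 : ω ≠ 0) :
    ∃ K : Subfield F, Nat.card K = q ∧ ∀ c ∈ K, c ≠ 0 → ∃ k : ℕ, c = (ω ^ (q + 1)) ^ k := by
  classical
  have hq1 := hq.one_lt
  have hord : orderOf ω = (q + 1) * (q - 1) := by
    rw [orderOf_primitive hω hω0, hF]
    simpa using Nat.sq_sub_sq q 1
  obtain ⟨p, n, hp, hn, rfl⟩ := (isPrimePow_nat_iff q).1 hq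
  have : Fact p.Prime := ⟨hp⟩
  have : CharP F p := by
    obtain ⟨p', hp'⟩ := CharP.exists F
    obtain ⟨m, hp'', hm⟩ := FiniteField.card F p'
    have : p' = p := by
      have h : p' ∣ (p ^ n) ^ 2 := by
        rw [← hF, hm]
        exact dvd_pow_self _ m.ne_zero
      exact (Nat.prime_dvd_prime_iff_eq hp'' hp).1 (hp''.dvd_of_dvd_pow (hp''.dvd_of_dvd_pow h))
    exact this ▸ hp'
  set K : Subfield F := (iterateFrobenius F p n).eqLocusField (RingHom.id F) with hK
  have hmem (c : F) : c ∈ K ↔ c ^ p ^ n = c := by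
    rw [hK, RingHom.mem_eqLocusField, iterateFrobenius_def, RingHom.id_apply]
  set q := p ^ n
  have hθ : orderOf (ω ^ (q + 1)) = q - 1 := by
    rw [orderOf_pow_of_dvd (by omega) (hord ▸ dvd_mul_right _ _), hord,
      Nat.mul_div_cancel_left _ (by omega)]
  have hgen (c : F) (hc : c ∈ K) (hc0 : c ≠ 0) : ∃ k : ℕ, c = (ω ^ (q + 1)) ^ k := by
    obtain ⟨k, rfl⟩ := hω c hc0
    rw [hmem] at hc
    have h1 : ω ^ (k * (q - 1)) = 1 := by
      apply mul_right_cancel₀ hc0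
      rw [one_mul, ← pow_add, ← Nat.mul_succ, Nat.succ_eq_add_one, Nat.sub_add_cancel hq1.le,
        pow_mul, hc]
    have h2 := orderOf_dvd_of_pow_eq_one h1
    rw [hord] at h2
    obtain ⟨m, rfl⟩ := Nat.dvd_of_mul_dvd_mul_right (by omega) h2
    exact ⟨m, pow_mul ..⟩
  refine ⟨K, ?_, hgen⟩
  have hunits : (Finset.univ.filter (fun c : F => c ∈ K)).erase 0 =
      (Finset.range (q - 1)).image (fun k => (ω ^ (q + 1)) ^ k) := by
    ext c
    simp only [Finset.mem_erase, Finset.mem_filter, Finset.mem_univ, true_and, Finset.mem_image,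
      Finset.mem_range]
    constructor
    · rintro ⟨hc0, hc⟩
      obtain ⟨k, rfl⟩ := hgen c hc hc0
      refine ⟨k % (q - 1), Nat.mod_lt _ (by omega), ?_⟩
      rw [← hθ, pow_mod_orderOf]
    · rintro ⟨k, -, rfl⟩
      refine ⟨pow_ne_zero _ (pow_ne_zero _ hω0), K.pow_mem ?_ _⟩
      rw [hmem]
      have : (q + 1) * q = (q + 1) * (q - 1) + (q + 1) := by
        obtain ⟨m, hm⟩ := Nat.exists_eq_add_of_lt hq1
        rw [hm]; simp; ring
      rw [← pow_mul, this, pow_add, ← hord, pow_orderOf_eq_one, one_mul]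
  have hcard := congrArg Finset.card hunits
  rw [Finset.card_erase_of_mem (by simp [K.zero_mem]), Finset.card_image_of_injOn] at hcard
  · have hc : Nat.card K = (Finset.univ.filter (fun c : F => c ∈ K)).card := by
      rw [Nat.card_eq_fintype_card, Fintype.card_subtype]
    have hpos : 0 < (Finset.univ.filter (fun c : F => c ∈ K)).card :=
      Finset.card_pos.2 ⟨0, by simp [K.zero_mem]⟩
    rw [Finset.card_range] at hcard
    omega
  · intro a ha b hb h
    simp only [Finset.coe_range, Set.mem_Iio] at ha hb
    exact pow_injOn_Iio_orderOf (by simpa [hθ] using ha) (by simpa [hθ] using hb) h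

theorem diffCount_image_mul {F : Type*} [Field F] [Fintype F] (E : Set F)
    [DecidablePred (· ∈ E)] {c : F} (hc : c ≠ 0)
    (x : F) :
    (diffCount ((fun y => c * y) '' E) ((fun y => c * y) '' E) x : ℤ) =
      correlation (fun y => if y ∈ E then 1 else 0) (fun y => if y ∈ E then 1 else 0)
        (c⁻¹ * x) := by
  have hset : {p : F × F | p.1 ∈ (fun y => c * y) '' E ∧ p.2 ∈ (fun y => c * y) '' E ∧
      p.1 - p.2 = x} = (fun v => (c * v + x, c * v)) ''
        (Finset.univ.filter (fun v => v + c⁻¹ * x ∈ E ∧ v ∈ E) : Finset F) := by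
    ext ⟨u, v⟩
    simp only [Set.mem_ofPred_eq, Set.mem_image, Finset.coe_filter, Finset.mem_univ, true_and,
      Prod.mk.injEq]
    constructor
    · rintro ⟨⟨a, ha, rfl⟩, ⟨b, hb, rfl⟩, rfl⟩
      refine ⟨b, ⟨?_, hb⟩, by ring, rfl⟩
      convert ha using 1
      field_simp
      ring
    · rintro ⟨b, ⟨h1, h2⟩, rfl, rfl⟩
      refine ⟨⟨_, h1, ?_⟩, ⟨b, h2, rfl⟩, by ring⟩
      field_simp
  have hinj : Function.Injective (fun v => (c * v + x, c * v)) := fun a b h =>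
    mul_left_cancel₀ hc (Prod.ext_iff.1 h).2
  rw [diffCount, hset, Set.ncard_image_of_injective _ hinj, Set.ncard_coe_finset, correlation,
    Finset.card_filter]
  push_cast
  refine Finset.sum_congr rfl fun v _ => ?_
  by_cases h1 : v + c⁻¹ * x ∈ E <;> by_cases h2 : v ∈ E <;> simp [h1, h2]

section Correlation

variable {F : Type*} [Field F] [Fintype F]

theorem sum_neg_comp (h : F → ℤ) : ∑ x, h (-x) = ∑ x, h x :=
  Equiv.sum_comp (Equiv.neg F) h

theorem correlation_add_self (h m : F → ℤ) (hm : ∀ x, m (-x) = m x) (x : F) :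
    correlation (fun y => h y + m y) (fun y => h y + m y) x =
      correlation h h x + correlation m (fun y => h y + h (-y)) x + correlation m m x := by
  have hswap : ∑ v, h (v + x) * m v = ∑ v, m (v + x) * h (-v) := by
    rw [← Equiv.sum_comp (Equiv.subRight x) (fun v => h (v + x) * m v),
      ← Equiv.sum_comp (Equiv.neg F)]
    refine Finset.sum_congr rfl fun v _ => ?_
    rw [← hm (v + x), mul_comm]
    simp [sub_eq_add_neg, add_comm]
  simp only [correlation, add_mul, mul_add, Finset.sum_add_distrib, hswap]
  ring

theorem correlation_neg (h : F → ℤ) (x : F) : correlation h h (-x) = correlation h h x := by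
  rw [correlation, ← Equiv.sum_comp (Equiv.addRight x)]
  simp [correlation, mul_comm]

theorem correlation_mul_left {h : F → ℤ} {c : F} (hc : c ≠ 0) (hh : ∀ x, h (c * x) = h x)
    (x : F) : correlation h h (c * x) = correlation h h x := by
  rw [correlation, ← (mulLeft_bijective₀ c hc).sum_comp]
  simp only [← mul_add, hh, correlation]

theorem sum_correlation (h : F → ℤ) : ∑ x, correlation h h x = (∑ x, h x) ^ 2 := by
  simp only [correlation]
  rw [Finset.sum_comm, sq, Finset.mul_sum]
  refine Finset.sum_congr rfl fun v _ => ?_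
  rw [← Finset.sum_mul, ← Equiv.sum_comp (Equiv.addLeft v) h]
  simp

/-- If `m` is a union of `b` punctured lines and `h + h ∘ neg` is a disjoint sum of `n - 2 * b`
punctured lines, only the autocorrelation of `h` and one linear term in `h` remain. -/
theorem correlation_add_self_of_invariant {K : Subfield F} [Fintype K]
    (hcard : Fintype.card F = Fintype.card K ^ 2) (hK : 1 < Fintype.card K) {h m : F → ℤ}
    (hh0 : h 0 = 0) (hm0 : m 0 = 0)
    (hm : ∀ c : K, c ≠ 0 → ∀ x, m (c * x) = m x)
    (hg : ∀ c : K, c ≠ 0 → ∀ x, h (c * x) + h (-(c * x)) = h x + h (-x))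
    (hmm : ∀ x, m x * m x = m x) (hmh : ∀ x, m x * (h x + h (-x)) = 0) {b : ℤ}
    (hsm : ∑ x, m x = b * (Fintype.card K - 1))
    (hsh : 2 * ∑ x, h x = (Fintype.card K - 2 * b) * (Fintype.card K - 1))
    {x : F} (hx : x ≠ 0) :
    correlation (fun y => h y + m y) (fun y => h y + m y) x =
      correlation h h x - b * (h x + h (-x))
        + (b * (Fintype.card K - 2 * b) + b ^ 2 - b) := by
  have hneg (x : F) : m (-x) = m x := by
    rw [← hm (-1) (neg_ne_zero.2 one_ne_zero) x]
    simp
  have hsg : ∑ x, (h x + h (-x)) = (Fintype.card K - 2 * b) * (Fintype.card K - 1) := by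
    rw [Finset.sum_add_distrib, sum_neg_comp, ← two_mul, hsh]
  have h1 := correlation_of_invariant (g := fun y => h y + h (-y)) hcard hm0 hm (by simp [hh0])
    hg hx
  have h2 := correlation_of_invariant hcard hm0 hm hm0 hm hx
  simp only [hmm, hmh, hsg, hsm, Finset.sum_const_zero] at h1 h2
  rw [correlation_add_self h m hneg]
  have hne : ((Fintype.card K : ℤ) - 1) ^ 2 ≠ 0 := pow_ne_zero _ (by omega)
  apply mul_left_cancel₀ hne
  linear_combination h1 + h2

/-- Autocorrelation sum over the multiples of `h` by powers of a primitive element. -/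
theorem card_mul_sum_correlation {w : F} (hw0 : w ≠ 0)
    (hw : ∀ x : F, x ≠ 0 → ∃ k : ℕ, x = w ^ k) {e : ℕ} {h : F → ℤ} (hh0 : h 0 = 0)
    (hhh : ∀ x, h x * h x = h x) (hneg : ∀ x, h (w ^ e * x) = h (-x)) (b : ℤ) {x : F}
    (hx : x ≠ 0) :
    ((Fintype.card F : ℤ) - 1) * ∑ r ∈ Finset.range e,
        (correlation h h (w ^ r * x) - b * (h (w ^ r * x) + h (-(w ^ r * x)))) =
      e * ((∑ y, h y) ^ 2 - ∑ y, h y - 2 * b * ∑ y, h y) := by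
  have hcorr (x : F) : correlation h h (w ^ e * x) = correlation h h x := by
    rw [← correlation_neg, ← neg_mul]
    exact correlation_mul_left (neg_ne_zero.2 (pow_ne_zero e hw0))
      (fun x => by rw [neg_mul, ← mul_neg, hneg, neg_neg]) x
  have h1 := card_mul_sum_range_of_invariant
    (f := fun y => correlation h h y - b * (h y + h (-y))) hw0 hw (N := e)
    (fun x => by rw [hcorr, ← mul_neg, hneg, hneg, neg_neg, add_comm (h (-x))]) hx
  rw [h1, Finset.sum_sub_distrib, ← Finset.mul_sum, Finset.sum_add_distrib,
    sum_neg_comp, sum_correlation]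
  simp only [correlation, add_zero, hhh, neg_zero, hh0]
  ring

end Correlation

theorem primitive_ne_zero {F : Type*} [Field F] [Fintype F] (hF : 2 < Fintype.card F) {ω : F}
    (hω : ∀ x : F, x ≠ 0 → ∃ k : ℕ, x = ω ^ k) : ω ≠ 0 := by
  classical
  rintro rfl
  obtain ⟨x, hx⟩ : ∃ x, x ∉ ({0, 1} : Finset F) := by
    by_contra! h
    have := (Finset.card_le_card (fun x _ => h x : Finset.univ ⊆ _)).trans Finset.card_le_two
    rw [Finset.card_univ] at this
    omega
  simp only [Finset.mem_insert, Finset.mem_singleton, not_or] at hx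
  obtain ⟨k, hk⟩ := hω x hx.1
  rcases Nat.eq_zero_or_pos k with rfl | hk0
  · exact hx.2 (by simpa using hk)
  · exact hx.1 (by rw [hk, zero_pow hk0.ne'])

theorem pow_eq_neg_one_of_orderOf_eq {F : Type*} [Field F] {ω : F} {n : ℕ} (hn : n ≠ 0)
    (h : orderOf ω = 2 * n) : ω ^ n = -1 := by
  have h1 : ω ^ n * ω ^ n = 1 := by rw [← pow_add, ← two_mul, ← h, pow_orderOf_eq_one]
  refine (mul_self_eq_one_iff.1 h1).resolve_left fun h2 => ?_
  have := Nat.le_of_dvd (Nat.pos_of_ne_zero hn) (h ▸ orderOf_dvd_of_pow_eq_one h2)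
  omega

theorem stmt_6 (q : ℕ) (hq : IsPrimePow q) (h4 : q % 4 = 3)
    (F : Type*) [Field F] [Fintype F] (hF : Fintype.card F = q ^ 2)
    (ω : F) (hω : ∀ x : F, x ≠ 0 → ∃ k : ℕ, x = ω ^ k)
    (e v : ℕ) (he : e = 2 ^ v) (hv : 2 ^ v ∣ q + 1) (hv' : ¬ 2 ^ (v + 1) ∣ q + 1)
    (α : ℕ) (hαodd : Odd α) (hα0 : 0 < α) (hαe : α < e)
    (β : ℕ) (hβ : (2 * e * β : ℤ) = q * e - α * (q + 1))
    (A : Finset ℕ) (hA : A ⊆ Finset.range (2 * e)) (hAcard : A.card = α)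
    (B : Fin e → Finset ℕ) (hB : ∀ r, B r ⊆ Finset.range (q + 1))
    (hBcard : ∀ r, (B r).card = β)
    (hAB : ∀ a ∈ A, ∀ r, ∀ b ∈ B r, (b : ZMod e) ≠ (a : ZMod e)) :
    let Hset : Set F := ⋃ i ∈ A, cyc ω (2 * e) i
    let M : Fin e → Set F := fun r => ⋃ j ∈ B r, cyc ω (q + 1) j
    let D : Fin e → Set F := fun r => (fun x => ω ^ (r : ℕ) * x) '' (Hset ∪ M r)
    (∀ r : Fin e, (D r).ncard = q * (q - 1) / 2) ∧
    ∀ x : F, x ≠ 0 → ∑ r : Fin e, diffCount (D r) (D r) x = e * q * (q - 2) / 4 := by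
  classical
  intro Hset M D
  have hq3 : 3 ≤ q := by omega
  have hcardZ : (Fintype.card F : ℤ) = (q : ℤ) ^ 2 := by exact_mod_cast hF
  have hω0 : ω ≠ 0 := primitive_ne_zero (by rw [hF]; nlinarith) hω
  have he0 : 0 < e := he ▸ Nat.two_pow_pos v
  obtain ⟨s, hs⟩ := hv
  rw [← he] at hs
  have hsodd : s % 2 = 1 := by
    by_contra hne
    obtain ⟨t, rfl⟩ : 2 ∣ s := by omega
    exact hv' ⟨t, by rw [hs, he]; ring⟩
  obtain ⟨u, hu⟩ : ∃ u, q = 4 * u + 3 := ⟨q / 4, by omega⟩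
  have hord : orderOf ω = (q + 1) * (q - 1) := by
    rw [orderOf_primitive hω hω0, hF]
    simpa using Nat.sq_sub_sq q 1
  have hcard1 : Fintype.card F - 1 = (q + 1) * (q - 1) := by
    rw [← hord, orderOf_primitive hω hω0]
  have hqm : q - 1 = 2 * (2 * u + 1) := by omega
  obtain ⟨t, ht⟩ : ∃ t, s * (2 * u + 1) = 2 * t + 1 := by
    obtain ⟨s', rfl⟩ : ∃ s', s = 2 * s' + 1 := ⟨s / 2, by omega⟩
    exact ⟨2 * s' * u + s' + u, by ring⟩
  have hord2 : orderOf ω = 2 * (e * (2 * t + 1)) := by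
    rw [hord, hs, hqm, ← ht]
    ring
  have hneg1 : ω ^ (e * (2 * t + 1)) = -1 :=
    pow_eq_neg_one_of_orderOf_eq (by positivity) hord2
  have h2e : 2 * e ∣ Fintype.card F - 1 :=
    ⟨2 * t + 1, by rw [← orderOf_primitive hω hω0, hord2]; ring⟩
  have hqd : q + 1 ∣ Fintype.card F - 1 := ⟨q - 1, hcard1⟩
  obtain ⟨K, hKcard, hKgen⟩ := exists_subfield_card hq hF hω hω0
  rw [Nat.card_eq_fintype_card] at hKcard
  set h : F → ℤ := fun y => if y ∈ Hset then 1 else 0 with hh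
  set m : Fin e → F → ℤ := fun r y => if y ∈ M r then 1 else 0 with hm
  have hh0 : h 0 = 0 := if_neg (by simp [Hset, zero_notMem_cyc hω0])
  have hm0 (r) : m r 0 = 0 := if_neg (by simp [M, zero_notMem_cyc hω0])
  have hhω (x : F) : h (ω ^ (2 * e) * x) = h x := by
    simp only [hh, Hset, Set.mem_iUnion, mul_mem_cyc_iff hω0]
  have hmω (r) (x : F) : m r (ω ^ (q + 1) * x) = m r x := by
    simp only [hm, M, Set.mem_iUnion, mul_mem_cyc_iff hω0]
  have hhneg (x : F) : h (ω ^ e * x) = h (-x) := by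
    rw [← neg_one_mul, ← hneg1, ← apply_pow_mul_of_invariant hhω t]
    congr 1
    ring
  have hgω (x : F) : h (ω ^ e * x) + h (-(ω ^ e * x)) = h x + h (-x) := by
    rw [← mul_neg, hhneg, hhneg, neg_neg, add_comm]
  have hgK (c : K) (hc : c ≠ 0) (x : F) : h (c * x) + h (-(c * x)) = h x + h (-x) := by
    obtain ⟨k, hk⟩ := hKgen c c.2 fun h => hc (Subtype.ext h)
    rw [hk, hs, pow_mul, ← pow_mul]
    exact apply_pow_mul_of_invariant (f := fun x => h x + h (-x)) hgω _ x
  have hmK (r) (c : K) (hc : c ≠ 0) (x : F) : m r (c * x) = m r x := by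
    obtain ⟨k, hk⟩ := hKgen c c.2 fun h => hc (Subtype.ext h)
    rw [hk]
    exact apply_pow_mul_of_invariant (hmω r) _ x
  have hdisj (r) (y : F) (hy : y ∈ M r) (n : ℕ) : ω ^ (e * n) * y ∉ Hset := by
    intro hy'
    simp only [M, Hset, Set.mem_iUnion, exists_prop] at hy hy'
    obtain ⟨b, hb, k, rfl⟩ := hy
    obtain ⟨a, ha, l, hl⟩ := hy'
    apply hAB a ha r b hb
    rw [← zpow_natCast, ← zpow_add₀ hω0] at hl
    obtain ⟨d, hd⟩ := dvd_sub_of_zpow_eq hω0 hl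
    have hsZ : (q : ℤ) + 1 = e * s := by exact_mod_cast hs
    rw [hord2] at hd
    push_cast at hd
    rw [← Int.cast_natCast b, ← Int.cast_natCast a, ZMod.intCast_eq_intCast_iff_dvd_sub]
    refine ⟨n + s * k - 2 * l - 2 * (2 * t + 1) * d, ?_⟩
    linear_combination (-1 : ℤ) * hd + k * hsZ
  have hMH (r) (y : F) (hy : y ∈ M r) : y ∉ Hset ∧ -y ∉ Hset := by
    refine ⟨by simpa using hdisj r y hy 0, ?_⟩
    rw [← neg_one_mul, ← hneg1]
    exact hdisj r y hy _
  have hsh : 2 * ∑ y, h y = ((q : ℤ) - 2 * β) * (q - 1) := by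
    have h1 := sum_indicator_cyc hω hω0 h2e hA
    rw [hAcard, hcardZ] at h1
    have he' : (e : ℤ) ≠ 0 := by exact_mod_cast he0.ne'
    apply mul_left_cancel₀ he'
    push_cast at h1
    change (2 * (e : ℤ)) * ∑ y, h y = _ at h1
    linear_combination h1 + ((q : ℤ) - 1) * hβ
  have hsm (r) : ∑ y, m r y = (β : ℤ) * (q - 1) := by
    have h1 := sum_indicator_cyc hω hω0 hqd (hB r)
    rw [hBcard, hcardZ] at h1
    have he' : (q : ℤ) + 1 ≠ 0 := by positivity
    apply mul_left_cancel₀ he'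
    push_cast at h1
    change ((q : ℤ) + 1) * ∑ y, m r y = _ at h1
    linear_combination h1
  have hE (r) : (fun y => if y ∈ Hset ∪ M r then (1 : ℤ) else 0) = fun y => h y + m r y := by
    funext y
    simp only [hh, hm, Set.mem_union]
    by_cases h1 : y ∈ M r
    · simp [h1, (hMH r y h1).1]
    · simp [h1]
  refine ⟨fun r => ?_, fun x hx => ?_⟩
  · have h1 : ((D r).ncard : ℤ) = ∑ y, (h y + m r y) := by
      rw [Set.ncard_image_of_injective _ (mul_right_injective₀ (pow_ne_zero _ hω0)), ← hE,
        Finset.sum_boole, ← Set.ncard_coe_finset]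
      congr 2
      ext y
      simp
    rw [Finset.sum_add_distrib, hsm] at h1
    have h2 : 2 * (D r).ncard = q * (q - 1) := by
      zify [show 1 ≤ q by omega]
      linear_combination 2 * h1 + hsh
    omega
  · have hw0 : ω⁻¹ ≠ 0 := inv_ne_zero hω0
    have hw (x : F) (hx : x ≠ 0) : ∃ k : ℕ, x = ω⁻¹ ^ k := by
      obtain ⟨k, hk⟩ := hω x⁻¹ (inv_ne_zero hx)
      exact ⟨k, by rw [inv_pow, ← hk, inv_inv]⟩
    have hwneg (x : F) : h (ω⁻¹ ^ e * x) = h (-x) := by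
      rw [← neg_neg (ω⁻¹ ^ e * x), ← hhneg, inv_pow, ← mul_neg,
        mul_inv_cancel_left₀ (pow_ne_zero e hω0)]
    have hr (r : Fin e) : (diffCount (D r) (D r) x : ℤ) =
        correlation h h (ω⁻¹ ^ (r : ℕ) * x)
          - β * (h (ω⁻¹ ^ (r : ℕ) * x) + h (-(ω⁻¹ ^ (r : ℕ) * x)))
          + (β * (q - 2 * β) + β ^ 2 - β) := by
      rw [diffCount_image_mul _ (pow_ne_zero _ hω0), hE, ← inv_pow]
      have := correlation_add_self_of_invariant (K := K) (h := h) (m := m r) (b := β)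
        (x := ω⁻¹ ^ (r : ℕ) * x) (by rw [hKcard, hF]) (by omega) hh0 (hm0 r) (hmK r) hgK
        (fun x => by by_cases h1 : x ∈ M r <;> simp [hm, h1])
        (fun x => by
          by_cases h1 : x ∈ M r
          · simp [hh, hMH r x h1]
          · simp [hm, h1])
        (by rw [hsm, hKcard]) (by rw [hsh, hKcard]) (mul_ne_zero (pow_ne_zero _ hw0) hx)
      rwa [hKcard] at this
    have hsum := card_mul_sum_correlation hw0 hw hh0
      (fun x => by by_cases h1 : x ∈ Hset <;> simp [hh, h1]) hwneg β hx
    have htotal : 4 * (∑ r : Fin e, diffCount (D r) (D r) x) = e * q * (q - 2) := by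
      zify [show 2 ≤ q by omega]
      rw [Finset.sum_congr rfl fun r _ => hr r, Finset.sum_add_distrib,
        Fin.sum_univ_eq_sum_range (fun r => correlation h h (ω⁻¹ ^ r * x)
          - β * (h (ω⁻¹ ^ r * x) + h (-(ω⁻¹ ^ r * x))))]
      rw [hcardZ] at hsum
      have hne : (q : ℤ) ^ 2 - 1 ≠ 0 := by nlinarith
      apply mul_left_cancel₀ hne
      simp only [Finset.sum_const, Finset.card_univ, Fintype.card_fin, nsmul_eq_mul]
      linear_combination 4 * hsum +
        (e : ℤ) * (2 * ∑ y, h y + ((q : ℤ) - 2 * β) * (q - 1) - 2 - 4 * β) * hsh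
    omega
end

section
/- Let q ≡ 3 (mod 8) be a prime power and F a finite field with q² elements with primitive element ω. For i, j ∈ ℤ/8ℤ define the cyclotomic number of order 8 by (i,j)₈ = |(Cᵢ⁽⁸⁾ + 1) ∩ Cⱼ⁽⁸⁾|, where Cᵢ⁽⁸⁾ + 1 = {x + 1 : x ∈ Cᵢ⁽⁸⁾}. Then there exist integers a, b with q² = a² + 2b² and a ≡ 1 (mod 4) such that: 64·(0,0)₈ = q² + 2q − 15; 64·(0,1)₈ = q² − 2q + 1 − 4a; 64·(0,2)₈ = q² − 6q + 1 + 8a; 64·(0,4)₈ = q² + 18q + 1; 64·(1,0)₈ = q² − 2q − 7 + 4a; 64·(1,2)₈ = q² + 6q + 1 + 4a + 16b; 64·(1,7)₈ = q² + 6q + 1 + 4a − 16b; and 64·(2,0)₈ = q² + 2q − 7 − 8a. -/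
/-- The cyclotomic number of order 8: `(i,j)₈ = |(C_i^{(8)} + 1) ∩ C_j^{(8)}|`. -/
noncomputable def cycNum {F : Type*} [Field F] (ω : F) (i j : ℤ) : ℕ :=
  Set.ncard (((fun x => x + 1) '' cyc ω 8 i) ∩ cyc ω 8 j)

namespace CyclotomicEight

open Finset ZMod

variable {F : Type*} [Field F]

/-- A multiplicative character sending `ω` to the standard primitive eighth root of unity. -/
lemma exists_mulChar [Fintype F] {ω : F} (hω : ∀ x : F, x ≠ 0 → ∃ k : ℕ, x = ω ^ k)
    (h8 : 8 ∣ Fintype.card F - 1) :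
    ∃ χ : MulChar F ℂ, χ ω = stdAddChar (1 : ZMod 8) := by
  classical
  have hω0 : ω ≠ 0 := by
    rintro rfl
    obtain ⟨k, hk⟩ := hω (-1) (by simp)
    rcases Nat.eq_zero_or_pos k with rfl | h
    · have h2 : ringChar F = 2 := by
        have : (2 : F) = 0 := by linear_combination -hk
        by_contra h
        exact Ring.two_ne_zero h this
      have := FiniteField.even_card_of_char_two h2
      have := Fintype.card_pos (α := F)
      omega
    · simp [h.ne'] at hk
  let g : Fˣ := Units.mk0 ω hω0
  have hg : ∀ x, x ∈ Subgroup.zpowers g := fun x => by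
    obtain ⟨k, hk⟩ := hω x x.ne_zero
    exact ⟨k, Units.ext (by simp [g, hk])⟩
  have he : stdAddChar (1 : ZMod 8) ^ (Fintype.card F - 1) = 1 := by
    obtain ⟨m, hm⟩ := h8
    rw [hm, ← AddChar.map_nsmul_eq_pow]
    have : (8 * m) • (1 : ZMod 8) = 0 := by
      rw [nsmul_eq_mul]
      push_cast
      rw [show (8 : ZMod 8) = 0 from rfl]
      simp
    rw [this, AddChar.map_zero_eq_one]
  have hne : stdAddChar (1 : ZMod 8) ≠ 0 := by
    intro h
    rw [h, zero_pow] at he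
    · exact zero_ne_one he
    · have := Fintype.one_lt_card (α := F)
      omega
  have hζ : Units.mk0 _ hne ∈ rootsOfUnity (Fintype.card Fˣ) ℂ := by
    rw [mem_rootsOfUnity, Fintype.card_units]
    exact Units.ext (by simpa using he)
  exact ⟨MulChar.ofRootOfUnity hζ hg, MulChar.ofRootOfUnity_spec hζ hg⟩

section Char

variable {χ : MulChar F ℂ} {ω : F}

lemma mulChar_inv (x : F) : χ x⁻¹ = (χ x)⁻¹ := by
  rw [← MulChar.inv_apply', MulChar.inv_apply_eq_inv']

lemma mulChar_zpow (hχ : χ ω = stdAddChar (1 : ZMod 8)) (n : ℤ) :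
    χ (ω ^ n) = stdAddChar (n : ZMod 8) := by
  have h : χ (ω ^ n) = χ ω ^ n := by
    cases n with
    | ofNat n => simp
    | negSucc n => rw [zpow_negSucc, zpow_negSucc, mulChar_inv, map_pow]
  rw [h, hχ, ← AddChar.map_zsmul_eq_zpow]
  simp

lemma stdAddChar_ne_zero (i : ZMod 8) : stdAddChar i ≠ 0 :=
  by
  simp [stdAddChar_apply]

lemma stdAddChar_four : stdAddChar (4 : ZMod 8) = -1 := by
  have h : stdAddChar (4 : ZMod 8) * stdAddChar (4 : ZMod 8) = 1 := by
    rw [← AddChar.map_add_eq_mul, show (4 + 4 : ZMod 8) = 0 from rfl, AddChar.map_zero_eq_one]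
  refine (mul_self_eq_one_iff.1 h).resolve_left fun h1 => ?_
  rw [← AddChar.map_zero_eq_one (stdAddChar (N := 8))] at h1
  exact absurd (injective_stdAddChar h1) (by decide)

lemma exists_mulChar_eq (hω : ∀ x : F, x ≠ 0 → ∃ k : ℕ, x = ω ^ k)
    (hχ : χ ω = stdAddChar (1 : ZMod 8)) {x : F} (hx : x ≠ 0) :
    ∃ i : ZMod 8, χ x = stdAddChar i := by
  obtain ⟨k, rfl⟩ := hω x hx
  exact ⟨_, mod_cast mulChar_zpow hχ k⟩

lemma ne_zero_of_mulChar_eq {x : F} {i : ZMod 8} (h : χ x = stdAddChar i) : x ≠ 0 := by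
  rintro rfl
  exact stdAddChar_ne_zero i (by rw [← h, χ.map_zero])

lemma mem_cyc_iff (hω : ∀ x : F, x ≠ 0 → ∃ k : ℕ, x = ω ^ k)
    (hχ : χ ω = stdAddChar (1 : ZMod 8)) (x : F) (i : ℤ) :
    x ∈ cyc ω 8 i ↔ χ x = stdAddChar (i : ZMod 8) := by
  constructor
  · rintro ⟨k, rfl⟩
    rw [mulChar_zpow hχ]
    push_cast
    rw [show (8 : ZMod 8) = 0 from rfl, zero_mul, add_zero]
  · intro h
    obtain ⟨k, rfl⟩ := hω x (ne_zero_of_mulChar_eq h)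
    rw [← zpow_natCast, mulChar_zpow hχ] at h
    have h' := injective_stdAddChar h
    rw [ZMod.intCast_eq_intCast_iff_dvd_sub] at h'
    obtain ⟨m, hm⟩ := h'
    refine ⟨-m, ?_⟩
    rw [← zpow_natCast]
    congr 1
    push_cast at hm ⊢
    linarith

lemma mulChar_two_sq {φ : F →+* F} {q : ℕ} (hφ : ∀ x, φ x = x ^ q) (h8 : q % 8 = 3)
    (hω : ∀ x : F, x ≠ 0 → ∃ k : ℕ, x = ω ^ k) (hχ : χ ω = stdAddChar (1 : ZMod 8))
    (h2 : (2 : F) ≠ 0) : χ 2 ^ 2 = 1 := by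
  obtain ⟨i, hi⟩ := exists_mulChar_eq hω hχ h2
  have h := hφ 2
  rw [map_ofNat] at h
  apply_fun χ at h
  rw [map_pow, hi, ← AddChar.map_nsmul_eq_pow] at h
  have h' := injective_stdAddChar h
  rw [nsmul_eq_mul, ← ZMod.natCast_mod, h8] at h'
  rw [hi, ← AddChar.map_nsmul_eq_pow, nsmul_eq_mul]
  have h2i : ((2 : ℕ) : ZMod 8) * i = 0 := by
    push_cast at h' ⊢
    linear_combination -h'
  rw [h2i, AddChar.map_zero_eq_one]

lemma mulChar_pow_ne_one (hχ : χ ω = stdAddChar (1 : ZMod 8)) {k : ℕ}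
    (hk : (k : ZMod 8) ≠ 0) : χ ^ k ≠ 1 := by
  intro h
  have hω0 := ne_zero_of_mulChar_eq hχ
  have hk0 : k ≠ 0 := by rintro rfl; simp at hk
  have h1 := congrArg (fun ψ : MulChar F ℂ => ψ ω) h
  simp only [MulChar.pow_apply' _ hk0, hχ, MulChar.one_apply hω0.isUnit,
    ← AddChar.map_nsmul_eq_pow] at h1
  rw [← AddChar.map_zero_eq_one (stdAddChar (N := 8))] at h1
  exact hk (by simpa using injective_stdAddChar h1)

variable [Fintype F]

open Classical in
/-- The number of `x` with `χ x = ζ₈ ^ i` and `χ (x + 1) = ζ₈ ^ j`. -/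
noncomputable def charCount (χ : MulChar F ℂ) (i j : ZMod 8) : ℕ :=
  #{x : F | χ x = stdAddChar i ∧ χ (x + 1) = stdAddChar j}

lemma cycNum_eq (hω : ∀ x : F, x ≠ 0 → ∃ k : ℕ, x = ω ^ k)
    (hχ : χ ω = stdAddChar (1 : ZMod 8)) (i j : ℤ) :
    cycNum ω i j = charCount χ i j := by
  classical
  symm
  rw [cycNum, charCount, ← Set.ncard_coe_finset,
    ← Set.ncard_image_of_injective _ (add_left_injective (1 : F))]
  congr 1
  ext y
  simp only [Set.mem_inter_iff, Set.mem_image, mem_cyc_iff hω hχ, coe_filter, mem_univ, true_and,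
    Set.mem_ofPred_eq]
  constructor
  · rintro ⟨x, ⟨hx, h⟩, rfl⟩
    exact ⟨⟨x, hx, rfl⟩, h⟩
  · rintro ⟨⟨x, hx, rfl⟩, h⟩
    exact ⟨x, ⟨hx, h⟩, rfl⟩

lemma charCount_le_of_injective {i j i' j' : ZMod 8} (f : F → F) (hf : Function.Injective f)
    (h : ∀ x, χ x = stdAddChar i → χ (x + 1) = stdAddChar j →
      χ (f x) = stdAddChar i' ∧ χ (f x + 1) = stdAddChar j') :
    charCount χ i j ≤ charCount χ i' j' := by
  classical
  refine card_le_card_of_injOn f (fun x hx => ?_) hf.injOn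
  simp only [coe_filter, mem_univ, true_and, Set.mem_ofPred_eq] at hx ⊢
  exact h x hx.1 hx.2

lemma charCount_mul_three {φ : F →+* F} {q : ℕ} (hφ : ∀ x, φ x = x ^ q) (hq : (q : ZMod 8) = 3)
    (i j : ZMod 8) : charCount χ i j = charCount χ (3 * i) (3 * j) := by
  have key (i j : ZMod 8) : charCount χ i j ≤ charCount χ (3 * i) (3 * j) := by
    refine charCount_le_of_injective φ φ.injective fun x hx hx' => ?_
    constructor
    · rw [hφ, map_pow, hx, ← AddChar.map_nsmul_eq_pow, nsmul_eq_mul, hq]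
    · rw [← map_one φ, ← map_add, hφ, map_pow, hx', ← AddChar.map_nsmul_eq_pow, nsmul_eq_mul, hq]
  refine le_antisymm (key i j) ((key _ _).trans_eq ?_)
  rw [← mul_assoc, ← mul_assoc, show (3 * 3 : ZMod 8) = 1 from rfl, one_mul, one_mul]

lemma charCount_neg (hneg : χ (-1) = stdAddChar (4 : ZMod 8)) (i j : ZMod 8) :
    charCount χ i j = charCount χ (j + 4) (i + 4) := by
  have key (i j : ZMod 8) : charCount χ i j ≤ charCount χ (j + 4) (i + 4) := by
    refine charCount_le_of_injective (fun x => -1 * (x + 1)) (fun x y h => by simpa using h)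
      fun x hx hx' => ⟨?_, ?_⟩
    · rw [map_mul, hneg, hx', ← AddChar.map_add_eq_mul, add_comm]
    · rw [show -1 * (x + 1) + 1 = -1 * x by ring, map_mul, hneg, hx, ← AddChar.map_add_eq_mul,
        add_comm]
  refine le_antisymm (key i j) ((key _ _).trans_eq ?_)
  rw [add_assoc, add_assoc, show (4 + 4 : ZMod 8) = 0 from rfl, add_zero, add_zero]

lemma charCount_inv (i j : ZMod 8) : charCount χ i j = charCount χ (-i) (j - i) := by
  have key (i j : ZMod 8) : charCount χ i j ≤ charCount χ (-i) (j - i) := by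
    refine charCount_le_of_injective (fun x => x⁻¹) inv_injective fun x hx hx' => ⟨?_, ?_⟩
    · rw [mulChar_inv, hx, AddChar.map_neg_eq_inv]
    · have := ne_zero_of_mulChar_eq hx
      rw [show x⁻¹ + 1 = (x + 1) * x⁻¹ by field_simp; ring, map_mul, mulChar_inv, hx, hx',
        sub_eq_add_neg, AddChar.map_add_eq_mul, AddChar.map_neg_eq_inv]
  refine le_antisymm (key i j) ((key _ _).trans_eq ?_)
  rw [neg_neg, sub_neg_eq_add, sub_add_cancel]

open Classical in
lemma card_mulChar_eq (hω : ∀ x : F, x ≠ 0 → ∃ k : ℕ, x = ω ^ k)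
    (hχ : χ ω = stdAddChar (1 : ZMod 8)) (i : ZMod 8) :
    8 * #{x : F | χ x = stdAddChar i} + 1 = Fintype.card F := by
  have step (i j : ZMod 8) :
      #{x : F | χ x = stdAddChar i} ≤ #{x : F | χ x = stdAddChar j} := by
    have hω0 : ω ≠ 0 := ne_zero_of_mulChar_eq hχ
    refine card_le_card_of_injOn (fun x => ω ^ (j - i).val * x) (fun x hx => ?_)
      (mul_right_injective₀ (pow_ne_zero _ hω0)).injOn
    simp only [coe_filter, mem_univ, true_and, Set.mem_ofPred_eq] at hx ⊢
    rw [map_mul, hx, ← zpow_natCast, mulChar_zpow hχ, ← AddChar.map_add_eq_mul]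
    simp
  have huniv : (univ : Finset F) =
      insert 0 (univ.biUnion fun j : ZMod 8 => {x : F | χ x = stdAddChar j}) := by
    ext x
    simp only [mem_univ, mem_insert, mem_biUnion, mem_filter, true_and, true_iff]
    by_cases hx : x = 0
    · exact Or.inl hx
    · exact Or.inr (exists_mulChar_eq hω hχ hx)
  rw [← card_univ (α := F), congrArg card huniv, card_insert_of_notMem, card_biUnion,
    sum_congr rfl fun j _ => le_antisymm (step j i) (step i j)]
  · simp
  · intro j _ k _ hjk
    refine disjoint_left.2 fun x hx hx' => hjk ?_
    simp only [mem_filter, mem_univ, true_and] at hx hx'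
    exact injective_stdAddChar (hx.symm.trans hx')
  · simp only [mem_biUnion, mem_filter, mem_univ, true_and, not_exists]
    exact fun j h => ne_zero_of_mulChar_eq h rfl

lemma sum_charCount (hω : ∀ x : F, x ≠ 0 → ∃ k : ℕ, x = ω ^ k)
    (hχ : χ ω = stdAddChar (1 : ZMod 8)) (hneg : χ (-1) = stdAddChar (4 : ZMod 8)) (i : ZMod 8) :
    8 * (∑ j, charCount χ i j + if i = 4 then 1 else 0) + 1 = Fintype.card F := by
  classical
  rw [← card_mulChar_eq hω hχ i]
  congr 2
  have hunion : ({x : F | χ x = stdAddChar i} : Finset F) =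
      (univ.biUnion fun j : ZMod 8 => {x : F | χ x = stdAddChar i ∧ χ (x + 1) = stdAddChar j}) ∪
        if i = 4 then {-1} else ∅ := by
    ext x
    simp only [mem_union, mem_biUnion, mem_filter, mem_univ, true_and]
    constructor
    · intro hx
      by_cases h : x + 1 = 0
      · right
        obtain rfl : x = -1 := eq_neg_of_add_eq_zero_left h
        rw [if_pos (injective_stdAddChar (hx.symm.trans hneg))]
        simp
      · obtain ⟨j, hj⟩ := exists_mulChar_eq hω hχ h
        exact Or.inl ⟨j, hx, hj⟩
    · rintro (⟨j, hx, -⟩ | h)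
      · exact hx
      · split_ifs at h with hi
        · rw [mem_singleton.1 h, hneg, hi]
        · simp at h
  rw [hunion, card_union_of_disjoint, card_biUnion]
  · congr 1
    split_ifs <;> simp
  · intro j _ k _ hjk
    refine disjoint_left.2 fun x hx hx' => hjk ?_
    simp only [mem_filter, mem_univ, true_and] at hx hx'
    exact injective_stdAddChar (hx.2.symm.trans hx'.2)
  · refine disjoint_right.2 fun x hx hx' => ?_
    split_ifs at hx
    · simp only [mem_biUnion, mem_filter, mem_univ, true_and] at hx'
      obtain ⟨j, -, hj⟩ := hx'
      rw [mem_singleton.1 hx, neg_add_cancel] at hj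
      exact ne_zero_of_mulChar_eq hj rfl
    · simp at hx

lemma jacobiSum_pow_eq_sum_charCount (hω : ∀ x : F, x ≠ 0 → ∃ k : ℕ, x = ω ^ k)
    (hχ : χ ω = stdAddChar (1 : ZMod 8)) (hneg : χ (-1) = -1) {a b : ℕ} (ha : a ≠ 0)
    (hb : b ≠ 0) :
    jacobiSum (χ ^ a) (χ ^ b) = ∑ i : ZMod 8, ∑ j : ZMod 8,
      (-stdAddChar i) ^ a * stdAddChar j ^ b * (charCount χ i j : ℂ) := by
  classical
  have hpt (x : F) : (χ ^ a) (-x) * (χ ^ b) (1 - -x) = ∑ i : ZMod 8, ∑ j : ZMod 8,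
      if χ x = stdAddChar i ∧ χ (x + 1) = stdAddChar j then
        (-stdAddChar i) ^ a * stdAddChar j ^ b else 0 := by
    rw [MulChar.pow_apply' _ ha, MulChar.pow_apply' _ hb, sub_neg_eq_add, add_comm 1 x,
      neg_eq_neg_one_mul x, map_mul, hneg]
    by_cases hx : x = 0
    · rw [sum_eq_zero fun i _ => sum_eq_zero fun j _ => if_neg fun h =>
        ne_zero_of_mulChar_eq h.1 hx]
      simp [hx, ha, MulChar.map_zero]
    by_cases hx' : x + 1 = 0
    · rw [sum_eq_zero fun i _ => sum_eq_zero fun j _ => if_neg fun h =>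
        ne_zero_of_mulChar_eq h.2 hx']
      simp [hx', hb, MulChar.map_zero]
    obtain ⟨i, hi⟩ := exists_mulChar_eq hω hχ hx
    obtain ⟨j, hj⟩ := exists_mulChar_eq hω hχ hx'
    rw [sum_eq_single i, sum_eq_single j]
    · simp [hi, hj]
    · intro k _ hk
      exact if_neg fun h => hk (injective_stdAddChar (h.2.symm.trans hj))
    · simp
    · intro k _ hk
      exact sum_eq_zero fun _ _ => if_neg fun h => hk (injective_stdAddChar (h.1.symm.trans hi))
    · simp
  rw [jacobiSum, ← Equiv.sum_comp (Equiv.neg F)]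
  simp only [Equiv.neg_apply, hpt]
  rw [sum_comm]
  refine sum_congr rfl fun i _ => ?_
  rw [sum_comm]
  refine sum_congr rfl fun j _ => ?_
  rw [charCount, ← sum_filter, sum_const, nsmul_eq_mul, mul_comm]

lemma mulChar_neg_one {q : ℕ} (hF : Fintype.card F = q ^ 2) (h8 : q % 8 = 3)
    (hω : ∀ x : F, x ≠ 0 → ∃ k : ℕ, x = ω ^ k) (hχ : χ ω = stdAddChar (1 : ZMod 8)) :
    χ (-1) = stdAddChar (4 : ZMod 8) := by
  classical
  obtain ⟨n, hn⟩ := hω (-1) (by simp)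
  have hω0 : ω ≠ 0 := ne_zero_of_mulChar_eq hχ
  obtain ⟨k, rfl⟩ : ∃ k, q = 8 * k + 3 := ⟨q / 8, by omega⟩
  have hcard : Fintype.card F - 1 = 8 * (2 * (4 * k ^ 2 + 3 * k) + 1) := by
    rw [hF, Nat.sub_eq_iff_eq_add (Nat.one_le_pow _ _ (by omega))]
    ring
  have h1 : (-1 : F) ≠ 1 := by
    refine Ring.neg_one_ne_one_of_char_ne_two fun h => ?_
    have := FiniteField.even_card_of_char_two h
    rw [hF, Nat.pow_mod, show (8 * k + 3) % 2 = 1 by omega] at this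
    omega
  have hord : Fintype.card F - 1 ∣ 2 * n := by
    have h2 : (ω ^ n) ^ 2 = 1 := by rw [← hn]; ring
    rw [← pow_mul, mul_comm] at h2
    refine dvd_trans ?_ (orderOf_dvd_of_pow_eq_one h2)
    have hg : ∀ x, x ∈ Subgroup.zpowers (Units.mk0 ω hω0) := fun x => by
      obtain ⟨k, hk⟩ := hω x x.ne_zero
      exact ⟨k, Units.ext (by simp [hk])⟩
    rw [← Fintype.card_units, ← Nat.card_eq_fintype_card,
      ← orderOf_eq_card_of_forall_mem_zpowers hg, ← orderOf_units, Units.val_mk0]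
  have hnd : ¬ Fintype.card F - 1 ∣ n := by
    rintro ⟨m, rfl⟩
    rw [pow_mul, FiniteField.pow_card_sub_one_eq_one ω hω0, one_pow] at hn
    exact h1 hn
  rw [hcard] at hord hnd
  set t := 4 * k ^ 2 + 3 * k
  have h4 : n % 8 = 4 := by
    have h4n : 4 ∣ n := by
      obtain ⟨m, hm⟩ := hord
      exact ⟨(2 * t + 1) * m, by linarith⟩
    by_contra hne
    refine hnd (Nat.Coprime.mul_dvd_of_dvd_of_dvd ?_ (by omega) ?_)
    · exact Nat.Coprime.pow_left 3 (Nat.coprime_two_left.2 ⟨t, rfl⟩)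
    · refine Nat.Coprime.dvd_of_dvd_mul_left (k := 2 * t + 1) (m := 2) ?_
        ((Dvd.intro_left 8 rfl).trans hord)
      exact Nat.coprime_two_right.2 ⟨t, rfl⟩
  rw [hn, ← zpow_natCast, mulChar_zpow hχ, Int.cast_natCast, ← ZMod.natCast_mod, h4]
  rfl

lemma mulChar_pow_four (hF : ringChar F ≠ 2) [DecidableEq F]
    (hω : ∀ x : F, x ≠ 0 → ∃ k : ℕ, x = ω ^ k) (hχ : χ ω = stdAddChar (1 : ZMod 8)) (x : F) :
    (χ ^ 4) x = quadraticChar F x := by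
  by_cases hx : x = 0
  · simp [hx, MulChar.map_zero]
  have hω' : quadraticChar F ω = -1 := by
    rw [quadraticChar_neg_one_iff_not_isSquare]
    rintro ⟨y, hy⟩
    obtain ⟨a, ha⟩ := FiniteField.exists_nonsquare hF
    have ha0 : a ≠ 0 := by rintro rfl; exact ha (IsSquare.zero)
    obtain ⟨k, rfl⟩ := hω a ha0
    exact ha ((show IsSquare ω from ⟨y, hy⟩).pow k)
  have hχ4 : (χ ^ 4) ω = -1 := by
    rw [MulChar.pow_apply' _ four_ne_zero, hχ, ← AddChar.map_nsmul_eq_pow]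
    exact stdAddChar_four
  obtain ⟨k, rfl⟩ := hω x hx
  rw [map_pow, map_pow, hω', hχ4]
  push_cast
  rfl

lemma jacobiSum_self_eq (hF : ringChar F ≠ 2) (hω : ∀ x : F, x ≠ 0 → ∃ k : ℕ, x = ω ^ k)
    (hχ : χ ω = stdAddChar (1 : ZMod 8)) (h2 : χ 2 ^ 2 = 1) (hχ1 : χ ≠ 1) :
    jacobiSum χ χ = jacobiSum χ (χ ^ 4) := by
  classical
  have h20 : (2 : F) ≠ 0 := Ring.two_ne_zero hF
  have hl : jacobiSum χ χ = ∑ y : F, χ (1 - y ^ 2) := by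
    rw [jacobiSum, ← Equiv.sum_comp ((Equiv.mulLeft₀ (2 : F) h20).trans (Equiv.subLeft 1))
      (fun y => χ (1 - y ^ 2))]
    refine sum_congr rfl fun x _ => ?_
    rw [← map_mul, ← one_mul (χ _), ← h2, ← map_pow, ← map_mul]
    congr 1
    simp only [Equiv.trans_apply, Equiv.mulLeft₀_apply, Equiv.subLeft_apply]
    ring
  have hsqrt (u : F) : (#{y : F | y ^ 2 = u} : ℂ) = (χ ^ 4) u + 1 := by
    rw [mulChar_pow_four hF hω hχ]
    have := quadraticChar_card_sqrts hF u
    rw [Set.toFinset_ofPred] at this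
    exact_mod_cast this
  rw [hl, ← sum_fiberwise_of_maps_to (t := univ) (g := fun y => y ^ 2) fun _ _ => mem_univ _]
  have (u : F) : ∑ y with y ^ 2 = u, χ (1 - y ^ 2) = (χ ^ 4) u * χ (1 - u) + χ (1 - u) := by
    rw [sum_congr rfl fun y hy => by rw [(mem_filter.1 hy).2], sum_const, nsmul_eq_mul, hsqrt]
    ring
  simp only [this]
  rw [sum_add_distrib, jacobiSum_comm χ, jacobiSum, add_eq_left,
    show ∑ x : F, χ (1 - x) = ∑ x : F, χ (Equiv.subLeft 1 x) from rfl,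
    Equiv.sum_comp (Equiv.subLeft (1 : F)) (fun x => χ x)]
  exact MulChar.sum_eq_zero_of_ne_one hχ1

lemma sum_zmod_eight {M : Type*} [AddCommMonoid M] (f : ZMod 8 → M) :
    ∑ i, f i = f 0 + f 1 + f 2 + f 3 + f 4 + f 5 + f 6 + f 7 :=
  Fin.sum_univ_eight f

/-- A function with the symmetries of the cyclotomic numbers of order eight has at most ten
different values, which determine its Jacobi-type sums. -/
lemma sums_of_symm {n : ZMod 8 → ZMod 8 → ℕ} (h3 : ∀ i j, n i j = n (3 * i) (3 * j))
    (hneg : ∀ i j, n i j = n (j + 4) (i + 4)) (hinv : ∀ i j, n i j = n (-i) (j - i)) {f : ℕ}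
    (hrow : ∀ i, ∑ j, n i j + (if i = 4 then 1 else 0) = f)
    {J : ℕ → ℕ → ℂ} (hJ : ∀ a b, a ≠ 0 → b ≠ 0 → J a b = ∑ i : ZMod 8, ∑ j : ZMod 8,
      (-stdAddChar i) ^ a * stdAddChar j ^ b * (n i j : ℂ)) {s : ℂ}
    (hs : s = stdAddChar (1 : ZMod 8) + stdAddChar (3 : ZMod 8)) :
    (n 0 0 + n 0 1 + n 0 2 + n 0 1 + n 0 4 + n 0 5 + n 0 2 + n 0 5 = f ∧
      n 1 0 + n 1 0 + n 1 2 + n 1 3 + n 0 5 + n 0 1 + n 1 3 + n 1 7 = f ∧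
      n 2 0 + n 1 3 + n 2 0 + n 1 7 + n 0 2 + n 1 3 + n 0 2 + n 1 2 = f ∧
      n 0 0 + n 1 0 + n 2 0 + n 1 0 + n 0 0 + n 1 0 + n 2 0 + n 1 0 + 1 = f) ∧
    J 1 1 = ((-n 0 0 - 2 * n 1 2 + 4 * n 1 3 - 2 * n 0 2 + 2 * n 2 0 + n 0 4 - 2 * n 1 7 : ℤ) : ℂ) +
      ((-2 * n 0 1 + 2 * n 1 7 + 2 * n 0 5 - 2 * n 1 2 : ℤ) : ℂ) * s ∧
    J 1 4 = ((n 0 0 - 4 * n 1 0 + 2 * n 2 0 + 2 * n 0 1 - 2 * n 0 2 - n 0 4 + 2 * n 0 5 : ℤ) : ℂ) +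
      ((-2 * n 0 5 + 2 * n 1 7 - 2 * n 1 2 + 2 * n 0 1 : ℤ) : ℂ) * s ∧
    J 1 5 = ((-n 0 0 + 2 * n 1 2 - 4 * n 1 3 - 2 * n 0 2 + 2 * n 2 0 + n 0 4 + 2 * n 1 7 : ℤ) : ℂ) ∧
    J 2 4 = ((3 * n 0 0 - 4 * n 1 0 - 2 * n 2 0 + 2 * n 1 7 - 2 * n 0 2 + 4 * n 1 3 + 2 * n 1 2
      - 2 * n 0 1 + n 0 4 - 2 * n 0 5 : ℤ) : ℂ) := by
  have e44 : n 4 4 = n 0 0 := hneg 4 4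
  have e40 : n 4 0 = n 0 0 := (hinv 4 0).trans e44
  have e03 : n 0 3 = n 0 1 := h3 0 3
  have e54 : n 5 4 = n 0 1 := hneg 5 4
  have e74 : n 7 4 = n 0 1 := (h3 7 4).trans e54
  have e15 : n 1 5 = n 0 1 := (hinv 1 5).trans e74
  have e37 : n 3 7 = n 0 1 := (h3 3 7).trans e15
  have e06 : n 0 6 = n 0 2 := h3 0 6
  have e24 : n 2 4 = n 0 2 := (hneg 2 4).trans e06
  have e62 : n 6 2 = n 0 2 := (hinv 6 2).trans e24
  have e64 : n 6 4 = n 0 2 := (h3 6 4).trans e24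
  have e26 : n 2 6 = n 0 2 := (h3 2 6).trans e62
  have e07 : n 0 7 = n 0 5 := h3 0 7
  have e14 : n 1 4 = n 0 5 := hneg 1 4
  have e34 : n 3 4 = n 0 5 := (h3 3 4).trans e14
  have e51 : n 5 1 = n 0 5 := (hinv 5 1).trans e34
  have e73 : n 7 3 = n 0 5 := (h3 7 3).trans e51
  have e30 : n 3 0 = n 1 0 := h3 3 0
  have e45 : n 4 5 = n 1 0 := hneg 4 5
  have e47 : n 4 7 = n 1 0 := (h3 4 7).trans e45
  have e55 : n 5 5 = n 1 0 := (hinv 5 5).trans e30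
  have e77 : n 7 7 = n 1 0 := (h3 7 7).trans e55
  have e11 : n 1 1 = n 1 0 := (hneg 1 1).trans e55
  have e33 : n 3 3 = n 1 0 := (h3 3 3).trans e11
  have e41 : n 4 1 = n 1 0 := (hinv 4 1).trans e45
  have e43 : n 4 3 = n 1 0 := (h3 4 3).trans e41
  have e50 : n 5 0 = n 1 0 := (hneg 5 0).trans e41
  have e70 : n 7 0 = n 1 0 := (h3 7 0).trans e50
  have e36 : n 3 6 = n 1 2 := h3 3 6
  have e53 : n 5 3 = n 1 2 := (hinv 5 3).trans e36
  have e65 : n 6 5 = n 1 2 := hneg 6 5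
  have e71 : n 7 1 = n 1 2 := (h3 7 1).trans e53
  have e27 : n 2 7 = n 1 2 := (h3 2 7).trans e65
  have e31 : n 3 1 = n 1 3 := h3 3 1
  have e56 : n 5 6 = n 1 3 := (hinv 5 6).trans e31
  have e57 : n 5 7 = n 1 3 := (hneg 5 7).trans e31
  have e72 : n 7 2 = n 1 3 := (h3 7 2).trans e56
  have e75 : n 7 5 = n 1 3 := (h3 7 5).trans e57
  have e16 : n 1 6 = n 1 3 := (hinv 1 6).trans e75
  have e21 : n 2 1 = n 1 3 := (hneg 2 1).trans e56
  have e25 : n 2 5 = n 1 3 := (hneg 2 5).trans e16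
  have e32 : n 3 2 = n 1 3 := (h3 3 2).trans e16
  have e63 : n 6 3 = n 1 3 := (h3 6 3).trans e21
  have e67 : n 6 7 = n 1 3 := (h3 6 7).trans e25
  have e35 : n 3 5 = n 1 7 := h3 3 5
  have e52 : n 5 2 = n 1 7 := (hinv 5 2).trans e35
  have e61 : n 6 1 = n 1 7 := (hneg 6 1).trans e52
  have e76 : n 7 6 = n 1 7 := (h3 7 6).trans e52
  have e23 : n 2 3 = n 1 7 := (h3 2 3).trans e61
  have e46 : n 4 6 = n 2 0 := hneg 4 6
  have e60 : n 6 0 = n 2 0 := h3 6 0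
  have e66 : n 6 6 = n 2 0 := hinv 6 6
  have e22 : n 2 2 = n 2 0 := (h3 2 2).trans e66
  have e42 : n 4 2 = n 2 0 := (h3 4 2).trans e46
  set z : ℂ := stdAddChar (1 : ZMod 8) with hz
  have z0 : stdAddChar (0 : ZMod 8) = 1 := AddChar.map_zero_eq_one _
  have z2 : stdAddChar (2 : ZMod 8) = z ^ 2 := by
    rw [hz, ← AddChar.map_nsmul_eq_pow]
    rfl
  have z3 : stdAddChar (3 : ZMod 8) = z ^ 3 := by
    rw [hz, ← AddChar.map_nsmul_eq_pow]
    rfl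
  have hadd (i : ZMod 8) : stdAddChar (4 + i) = -stdAddChar i := by
    rw [AddChar.map_add_eq_mul, stdAddChar_four, neg_one_mul]
  have z5 : stdAddChar (5 : ZMod 8) = -z := hadd 1
  have z6 : stdAddChar (6 : ZMod 8) = -z ^ 2 := by rw [← z2]; exact hadd 2
  have z7 : stdAddChar (7 : ZMod 8) = -z ^ 3 := by rw [← z3]; exact hadd 3
  have hz4 : z ^ 4 = -1 := by
    rw [hz, ← AddChar.map_nsmul_eq_pow, ← stdAddChar_four]
    rfl
  have hz4' (k : ℕ) : z ^ (k + 4) = -z ^ k := by rw [pow_add, hz4, mul_neg_one]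
  have p5 : z ^ 5 = -z ^ 1 := hz4' 1
  have p6 : z ^ 6 = -z ^ 2 := hz4' 2
  have p7 : z ^ 7 = -z ^ 3 := hz4' 3
  have p8 : z ^ 8 = -z ^ 4 := hz4' 4
  have p9 : z ^ 9 = -z ^ 5 := hz4' 5
  have p10 : z ^ 10 = -z ^ 6 := hz4' 6
  have p11 : z ^ 11 = -z ^ 7 := hz4' 7
  have p12 : z ^ 12 = -z ^ 8 := hz4' 8
  have p13 : z ^ 13 = -z ^ 9 := hz4' 9
  have p14 : z ^ 14 = -z ^ 10 := hz4' 10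
  have p15 : z ^ 15 = -z ^ 11 := hz4' 11
  have p16 : z ^ 16 = -z ^ 12 := hz4' 12
  have p17 : z ^ 17 = -z ^ 13 := hz4' 13
  have p18 : z ^ 18 = -z ^ 14 := hz4' 14
  have r0 := hrow 0
  have r1 := hrow 1
  have r2 := hrow 2
  have r4 := hrow 4
  rw [if_neg (by decide), add_zero] at r0 r1 r2
  rw [if_pos rfl] at r4
  simp only [sum_zmod_eight,
    e44, e40, e03, e15, e06, e24, e26, e07, e14, e45, e47, e11, e41, e43, e27, e16, e21, e25,
    e23, e46, e22, e42]
    at r0 r1 r2 r4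
  refine ⟨⟨r0, r1, r2, r4⟩, ?_, ?_, ?_, ?_⟩
  all_goals
    rw [hJ _ _ (by decide) (by decide)]
    simp only [hs, sum_zmod_eight, z0, z2, z3, z5, z6, z7, stdAddChar_four, ← hz,
    e44, e40, e03, e54, e74, e15, e37, e06, e24, e62, e64, e26, e07, e14, e34, e51, e73, e30,
    e45, e47, e55, e77, e11, e33, e41, e43, e50, e70, e36, e53, e65, e71, e27, e31, e56, e57,
    e72, e75, e16, e21, e25, e32, e63, e67, e35, e52, e61, e76, e23, e46, e60, e66, e22, e42]
    push_cast
    ring_nf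
    simp only [hz4, p5, p6, p7, p8, p9, p10, p11, p12, p13, p14, p15, p16, p17, p18]
    ring

/-- The Hasse–Davenport product relation for `χ` and `χ ^ 4`, in terms of Jacobi sums. -/
lemma jacobiSum_one_five (hχ : χ ω = stdAddChar (1 : ZMod 8))
    (h : jacobiSum χ χ = jacobiSum χ (χ ^ 4)) :
    jacobiSum χ (χ ^ 5) = jacobiSum (χ ^ 2) (χ ^ 4) := by
  let ψ := AddChar.FiniteField.primitiveChar_to_Complex F
  have hψ : ψ.IsPrimitive := AddChar.FiniteField.primitiveChar_to_Complex_isPrimitive F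
  have hne (k : ℕ) (hk : (k : ZMod 8) ≠ 0) : gaussSum (χ ^ k) ψ ≠ 0 :=
    gaussSum_ne_zero_of_nontrivial (by simp) (mulChar_pow_ne_one hχ hk) hψ
  have hmul (a b : ℕ) (hk : ((a + b : ℕ) : ZMod 8) ≠ 0) :
      gaussSum (χ ^ (a + b)) ψ * jacobiSum (χ ^ a) (χ ^ b) =
        gaussSum (χ ^ a) ψ * gaussSum (χ ^ b) ψ := by
    rw [pow_add]
    exact jacobiSum_mul_nontrivial (by rw [← pow_add]; exact mulChar_pow_ne_one hχ hk) ψ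
  have h11 := hmul 1 1 (by decide)
  have h14 := hmul 1 4 (by decide)
  have h15 := hmul 1 5 (by decide)
  have h24 := hmul 2 4 (by decide)
  have h1 := hne 1 (by decide)
  simp only [Nat.reduceAdd] at h11 h14 h15 h24
  simp only [pow_one] at h11 h14 h15 h1
  rw [← h] at h14
  have hJ : jacobiSum χ χ ≠ 0 := by
    intro h0
    rw [h0, mul_zero] at h11
    exact mul_ne_zero h1 h1 h11.symm
  refine mul_left_cancel₀ (mul_ne_zero (hne 6 (by decide)) hJ) ?_
  linear_combination jacobiSum χ χ * h15 - jacobiSum χ χ * h24 + gaussSum χ ψ * h14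
    - gaussSum (χ ^ 4) ψ * h11

lemma jacobiSum_inv_eq_conj (χ ψ : MulChar F ℂ) :
    jacobiSum χ⁻¹ ψ⁻¹ = starRingEnd ℂ (jacobiSum χ ψ) := by
  simp only [jacobiSum, map_sum, map_mul, ← MulChar.star_apply', starRingEnd_apply]

end Char

lemma stdAddChar_one_add_three_sq :
    (stdAddChar (1 : ZMod 8) + stdAddChar (3 : ZMod 8)) ^ 2 = -2 := by
  have h (i j : ZMod 8) := AddChar.map_add_eq_mul (stdAddChar (N := 8)) i j
  have h11 := h 1 1
  have h13 := h 1 3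
  have h33 := h 4 (1 + 1)
  have h33' := h 3 3
  rw [show (3 + 3 : ZMod 8) = 4 + (1 + 1) from rfl, h33, h11] at h33'
  rw [show (1 + 3 : ZMod 8) = 4 from rfl] at h13
  rw [stdAddChar_four] at h13 h33'
  linear_combination -2 * h13 - h33'

lemma conj_stdAddChar_one_add_three :
    starRingEnd ℂ (stdAddChar (1 : ZMod 8) + stdAddChar (3 : ZMod 8)) =
      -(stdAddChar (1 : ZMod 8) + stdAddChar (3 : ZMod 8)) := by
  rw [map_add, ← AddChar.map_neg_eq_conj, ← AddChar.map_neg_eq_conj,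
    show (-1 : ZMod 8) = 4 + 3 from rfl, show (-3 : ZMod 8) = 4 + 1 from rfl,
    AddChar.map_add_eq_mul, AddChar.map_add_eq_mul, stdAddChar_four]
  ring

lemma eq_and_eq_of_add_mul_eq {s : ℂ} (hs : s ^ 2 = -2) {x y x' y' : ℤ}
    (h : (x : ℂ) + y * s = x' + y' * s) : x = x' ∧ y = y' := by
  have h1 : ((x - x' : ℤ) : ℂ) ^ 2 = -2 * ((y - y' : ℤ) : ℂ) ^ 2 := by
    push_cast
    have : (x : ℂ) - x' = -(y - y') * s := by linear_combination h
    rw [this, mul_pow, hs]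
    ring
  have h2 : (x - x') ^ 2 = -2 * (y - y') ^ 2 := by exact_mod_cast h1
  constructor <;> nlinarith [sq_nonneg (x - x'), sq_nonneg (y - y')]

end CyclotomicEight

open CyclotomicEight ZMod in
theorem stmt_12 (q : ℕ) (hq : IsPrimePow q) (h8 : q % 8 = 3)
    (F : Type*) [Field F] [Fintype F] (hF : Fintype.card F = q ^ 2)
    (ω : F) (hω : ∀ x : F, x ≠ 0 → ∃ k : ℕ, x = ω ^ k) :
    ∃ a b : ℤ, (q : ℤ) ^ 2 = a ^ 2 + 2 * b ^ 2 ∧ a % 4 = 1 ∧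
      64 * (cycNum ω 0 0 : ℤ) = (q : ℤ) ^ 2 + 2 * q - 15 ∧
      64 * (cycNum ω 0 1 : ℤ) = (q : ℤ) ^ 2 - 2 * q + 1 - 4 * a ∧
      64 * (cycNum ω 0 2 : ℤ) = (q : ℤ) ^ 2 - 6 * q + 1 + 8 * a ∧
      64 * (cycNum ω 0 4 : ℤ) = (q : ℤ) ^ 2 + 18 * q + 1 ∧
      64 * (cycNum ω 1 0 : ℤ) = (q : ℤ) ^ 2 - 2 * q - 7 + 4 * a ∧
      64 * (cycNum ω 1 2 : ℤ) = (q : ℤ) ^ 2 + 6 * q + 1 + 4 * a + 16 * b ∧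
      64 * (cycNum ω 1 7 : ℤ) = (q : ℤ) ^ 2 + 6 * q + 1 + 4 * a - 16 * b ∧
      64 * (cycNum ω 2 0 : ℤ) = (q : ℤ) ^ 2 + 2 * q - 7 - 8 * a := by
  obtain ⟨p, m, hp, hm, rfl⟩ := hq
  have hp' : p.Prime := hp.nat_prime
  have : Fact p.Prime := ⟨hp'⟩
  have : CharP F p := charP_of_card_eq_prime_pow (f := m * 2) (by rw [hF, pow_mul])
  set q := p ^ m with hqdef
  have hchar : ringChar F ≠ 2 := by
    rw [ringChar.eq F p]
    rintro rfl
    have := dvd_pow_self 2 hm.ne'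
    omega
  have hcharC : ringChar ℂ ≠ ringChar F := by
    rw [ringChar.eq F p, ringChar.eq ℂ 0]
    exact hp'.ne_zero.symm
  have hφ (x : F) : iterateFrobenius F p m x = x ^ q := iterateFrobenius_def ..
  obtain ⟨k, hk⟩ : ∃ k, q = 8 * k + 3 := ⟨q / 8, by omega⟩
  have hcard : Fintype.card F = 8 * (8 * (k * k) + 6 * k + 1) + 1 := by
    rw [hF, hk]
    ring
  obtain ⟨χ, hχ⟩ := exists_mulChar hω (by rw [hcard]; simp)
  have hneg := mulChar_neg_one hF h8 hω hχ
  have hdup := jacobiSum_self_eq hchar hω hχ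
    (mulChar_two_sq hφ h8 hω hχ (Ring.two_ne_zero hchar))
    (by simpa using mulChar_pow_ne_one hχ (k := 1) (by decide))
  have hq3 : (q : ZMod 8) = 3 := by
    rw [← ZMod.natCast_mod, h8]
    rfl
  set s : ℂ := stdAddChar (1 : ZMod 8) + stdAddChar (3 : ZMod 8) with hs
  have hs2 : s ^ 2 = -2 := stdAddChar_one_add_three_sq
  obtain ⟨⟨hr0, hr1, hr2, hr4⟩, hJ11, hJ14, hJ15, hJ24⟩ :=
    sums_of_symm (charCount_mul_three hφ hq3) (charCount_neg hneg) charCount_inv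
      (f := 8 * (k * k) + 6 * k + 1)
      (fun i => by
        have := sum_charCount hω hχ hneg i
        omega)
      (fun a b => jacobiSum_pow_eq_sum_charCount hω hχ (hneg.trans stdAddChar_four)) hs
  have hnorm (a b : ℕ) (ha : (a : ZMod 8) ≠ 0) (hb : (b : ZMod 8) ≠ 0)
      (hab : ((a + b : ℕ) : ZMod 8) ≠ 0) :
      jacobiSum (χ ^ a) (χ ^ b) * starRingEnd ℂ (jacobiSum (χ ^ a) (χ ^ b)) = (q : ℂ) ^ 2 := by
    rw [← jacobiSum_inv_eq_conj, jacobiSum_mul_jacobiSum_inv hcharC (mulChar_pow_ne_one hχ ha)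
      (mulChar_pow_ne_one hχ hb) (by rw [← pow_add]; exact mulChar_pow_ne_one hχ hab), hF]
    push_cast
    rfl
  have hn11 := hnorm 1 1 (by decide) (by decide) (by decide)
  have hn24 := hnorm 2 4 (by decide) (by decide) (by decide)
  have h15 := jacobiSum_one_five hχ hdup
  rw [hJ11, map_add, map_mul, conj_stdAddChar_one_add_three, ← hs, map_intCast,
    map_intCast] at hn11
  rw [hJ24, map_intCast] at hn24
  simp only [pow_one] at hJ11 hJ14 hJ15
  rw [hJ11, hJ14] at hdup
  rw [hJ15, hJ24] at h15
  obtain ⟨hX, hY⟩ := eq_and_eq_of_add_mul_eq hs2 hdup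
  have hE := Int.cast_injective h15
  have hcyc := cycNum_eq hω hχ
  simp only [hcyc, Int.cast_zero, Int.cast_one, Int.cast_ofNat]
  generalize charCount χ 0 0 = n00 at *
  generalize charCount χ 0 1 = n01 at *
  generalize charCount χ 0 2 = n02 at *
  generalize charCount χ 0 4 = n04 at *
  generalize charCount χ 0 5 = n05 at *
  generalize charCount χ 1 0 = n10 at *
  generalize charCount χ 1 2 = n12 at *
  generalize charCount χ 1 3 = n13 at *
  generalize charCount χ 1 7 = n17 at *
  generalize charCount χ 2 0 = n20 at *
  clear_value s q
  have hq2 : (q : ℤ) ^ 2 = 64 * ((k * k : ℕ) : ℤ) + 48 * k + 9 := by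
    rw [hk]
    push_cast
    ring
  have hnX : (-n00 - 2 * n12 + 4 * n13 - 2 * n02 + 2 * n20 + n04 - 2 * n17 : ℤ) ^ 2 +
      2 * (-2 * n01 + 2 * n17 + 2 * n05 - 2 * n12 : ℤ) ^ 2 = (q : ℤ) ^ 2 := by
    have : (((-n00 - 2 * n12 + 4 * n13 - 2 * n02 + 2 * n20 + n04 - 2 * n17 : ℤ) ^ 2 +
      2 * (-2 * n01 + 2 * n17 + 2 * n05 - 2 * n12 : ℤ) ^ 2 : ℤ) : ℂ) = ((q : ℤ) ^ 2 : ℤ) := by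
      rw [Int.cast_add, Int.cast_mul, Int.cast_pow, Int.cast_pow]
      push_cast at hn11 ⊢
      linear_combination hn11 + (-2 * n01 + 2 * n17 + 2 * n05 - 2 * n12 : ℂ) ^ 2 * hs2
    exact Int.cast_injective this
  have hsign : (3 * n00 - 4 * n10 - 2 * n20 + 2 * n17 - 2 * n02 + 4 * n13 + 2 * n12
      - 2 * n01 + n04 - 2 * n05 : ℤ) = q ∨ (3 * n00 - 4 * n10 - 2 * n20 + 2 * n17 - 2 * n02
      + 4 * n13 + 2 * n12 - 2 * n01 + n04 - 2 * n05 : ℤ) = -q := by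
    refine sq_eq_sq_iff_eq_or_eq_neg.1 ?_
    rw [sq]
    exact_mod_cast hn24
  generalize k * k = K at *
  clear hn11 hn24 hnorm hdup h15 hJ11 hJ14 hJ15 hJ24 hcyc
  refine ⟨-(-n00 - 2 * n12 + 4 * n13 - 2 * n02 + 2 * n20 + n04 - 2 * n17),
    -(-2 * n01 + 2 * n17 + 2 * n05 - 2 * n12), by linarith, ?_⟩
  rw [hq2]
  clear hnX
  rcases hsign with hsign | hsign
  · refine ⟨?_, ?_, ?_, ?_, ?_, ?_, ?_, ?_, ?_⟩ <;> omega
  · omega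
end
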